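/- Let α > -1 and let β be a negative integer with -β ≤ n. Then for every i with -β ≤ i ≤ n and all real x, the generalized Jacobi polynomial Ĵ_i^{(α,β)}(x) := x^{-β} R_{i+β}^{(α,-β)}(x) satisfies Ĵ_i^{(α,β)}(x) = Σ_{h=-β}^{n} C(n,h)^{-1} C(n+β, h+β) a_{i+β, h+β}^{(n+β, α, -β)} B_h^n(x). -/

import Mathlib

open Finset

/-- Pochhammer symbol `(x)_m = x (x+1) ⋯ (x+m-1)`. -/
noncomputable def poch (x : ℝ) (m : ℕ) : ℝ := ∏ j ∈ Finset.range m, (x + j)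

/-- Bernstein polynomial `B_j^n(x) = C(n,j) x^j (1-x)^(n-j)`. -/
noncomputable def bern (n j : ℕ) (x : ℝ) : ℝ := (n.choose j : ℝ) * x ^ j * (1 - x) ^ (n - j)

/-- Shifted Jacobi polynomial `R_i^(a,b)(x)`. -/
noncomputable def shiftedJacobi (a b : ℝ) (i : ℕ) (x : ℝ) : ℝ :=
  poch (a + 1) i / (Nat.factorial i : ℝ) *
    ∑ j ∈ Finset.range (i + 1),
      poch (-(i : ℝ)) j * poch ((i : ℝ) + a + b + 1) j /
        ((Nat.factorial j : ℝ) * poch (a + 1) j) * (1 - x) ^ j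

/-- Hahn polynomial `Q_m(t; a, b, N)`. -/
noncomputable def hahnQ (m : ℕ) (t : ℝ) (a b : ℝ) (N : ℕ) : ℝ :=
  ∑ j ∈ Finset.range (m + 1),
    poch (-(m : ℝ)) j * poch ((m : ℝ) + a + b + 1) j * poch (-t) j /
      ((Nat.factorial j : ℝ) * poch (a + 1) j * poch (-(N : ℝ)) j)

/-- Dual Hahn polynomial `R_m(λ(t); a, b, N)` with `λ(t) = t(t+a+b+1)`. -/
noncomputable def dualHahnR (m : ℕ) (t : ℝ) (a b : ℝ) (N : ℕ) : ℝ :=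
  ∑ j ∈ Finset.range (m + 1),
    poch (-(m : ℝ)) j * poch (t + a + b + 1) j * poch (-t) j /
      ((Nat.factorial j : ℝ) * poch (a + 1) j * poch (-(N : ℝ)) j)

/-- Modified Jacobi polynomial `J_{i,k,l}^(α,β)(x) = (1-x)^l x^k R_{i-k-l}^(α+2l,β+2k)(x)`. -/
noncomputable def modJacobi (α β : ℝ) (k l i : ℕ) (x : ℝ) : ℝ :=
  (1 - x) ^ l * x ^ k * shiftedJacobi (α + 2 * l) (β + 2 * k) (i - k - l) x

/-- Connection coefficient `c_{ih}` of the Bernstein form of the modified Jacobi polynomials. -/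
noncomputable def cCoef (α β : ℝ) (n k l i h : ℕ) : ℝ :=
  poch (α + 2 * l + 1) (i - k - l) / (Nat.factorial (i - k - l) : ℝ) *
    (n.choose h : ℝ)⁻¹ * ((n - k - l).choose (h - k) : ℝ) *
    hahnQ (i - k - l) ((n : ℝ) - l - h) (α + 2 * l) (β + 2 * k) (n - k - l)

/-- The quantity `z_{hi}`. -/
noncomputable def zCoef (α β : ℝ) (n k l h i : ℕ) : ℝ :=
  (n.choose h : ℝ) * (2 * (i : ℝ) + (α + β + 1)) * poch ((k : ℝ) + l - n) (i - k - l) *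
      poch (α + 2 * l + 1) (n - l - h) * poch (β + 2 * k + 1) (h - k) /
    (poch (α + 2 * l + 1) (i - k - l) * poch ((i : ℝ) + k + l + (α + β + 1)) (n + 1 - k - l))

/-- The quantity `w_{hi}`. -/
noncomputable def wCoef (α β : ℝ) (n k l h i : ℕ) : ℝ :=
  hahnQ (i - k - l) ((h : ℝ) - k) (β + 2 * k) (α + 2 * l) (n - k - l)

/-- Connection coefficient `d_{hi}` of the modified Jacobi form of Bernstein polynomials. -/
noncomputable def dCoef (α β : ℝ) (n k l h i : ℕ) : ℝ := zCoef α β n k l h i * wCoef α β n k l h i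

/-- Coefficient `a_{ih}^(m,a,b) = (-1)^i ((b+1)_i / i!) Q_i(h; b, a, m)`. -/
noncomputable def aCoef (m : ℕ) (a b : ℝ) (i h : ℕ) : ℝ :=
  (-1 : ℝ) ^ i * poch (b + 1) i / (Nat.factorial i : ℝ) * hahnQ i (h : ℝ) b a m

/-- Coefficient `b_{hi}^(m,a,b)`. -/
noncomputable def bCoef (m : ℕ) (a b : ℝ) (h i : ℕ) : ℝ :=
  (m.choose h : ℝ) * (2 * (i : ℝ) + a + b + 1) * poch (-(m : ℝ)) i * poch (a + 1) (m - h) *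
      poch (b + 1) h / (poch (a + 1) i * poch ((i : ℝ) + a + b + 1) (m + 1)) *
    hahnQ i (h : ℝ) b a m

theorem poch_zero (c : ℝ) : poch c 0 = 1 := by simp [poch]

theorem poch_succ (c : ℝ) (m : ℕ) : poch c (m + 1) = poch c m * (c + m) := by
  simp [poch, Finset.prod_range_succ]

theorem poch_succ' (c : ℝ) (m : ℕ) : poch c (m + 1) = c * poch (c + 1) m := by
  simp only [poch, Finset.prod_range_succ', Nat.cast_add, Nat.cast_one, Nat.cast_zero, add_zero]
  rw [mul_comm]
  congr 1
  exact Finset.prod_congr rfl fun j _ => by ring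

theorem poch_add (c : ℝ) (m p : ℕ) : poch c (m + p) = poch c m * poch (c + m) p := by
  simp only [poch, Finset.prod_range_add, Nat.cast_add, add_assoc]

theorem poch_pos {c : ℝ} (hc : 0 < c) (m : ℕ) : 0 < poch c m :=
  Finset.prod_pos fun j _ => by positivity

theorem poch_neg_natCast (h j : ℕ) :
    poch (-(h : ℝ)) j = (-1) ^ j * (j.factorial : ℝ) * (h.choose j : ℝ) := by
  have key : poch (-(h : ℝ)) j = (-1) ^ j * (h.descFactorial j : ℝ) := by
    induction j with
    | zero => simp [poch]
    | succ j ih =>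
      rw [poch_succ, ih, Nat.descFactorial_succ]
      rcases le_or_gt j h with hj | hj
      · push_cast [hj]
        ring
      · simp [Nat.descFactorial_eq_zero_iff_lt.mpr hj]
  rw [key, Nat.descFactorial_eq_factorial_mul_choose]
  push_cast
  ring

/-- The terminating hypergeometric sum `(d)_N ₂F₁(-N, c; d; y)`, cleared of denominators. -/
noncomputable def hypSum (N : ℕ) (c d y : ℝ) : ℝ :=
  ∑ p ∈ antidiagonal N, (N.choose p.1 : ℝ) * ((-1) ^ p.1 * poch c p.1 * poch (d + p.1) p.2 * y ^ p.1)

theorem hypSum_succ (N : ℕ) (c d y : ℝ) :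
    hypSum (N + 1) c d y = (d + N) * hypSum N c d y - c * y * hypSum N (c + 1) (d + 1) y := by
  unfold hypSum
  rw [Finset.sum_antidiagonal_choose_succ_mul
    (fun s t => (-1) ^ s * poch c s * poch (d + s) t * y ^ s) N, Finset.mul_sum, Finset.mul_sum,
    sub_eq_add_neg, ← Finset.sum_neg_distrib]
  congr 1
  · refine Finset.sum_congr rfl fun p hp => ?_
    obtain rfl := mem_antidiagonal.mp hp
    rw [poch_succ]
    push_cast
    ring
  · refine Finset.sum_congr rfl fun p hp => ?_
    obtain rfl := mem_antidiagonal.mp hp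
    rw [poch_succ', Nat.choose_symm_add]
    push_cast
    rw [show d + 1 + (p.1 : ℝ) = d + (p.1 + 1) by ring]
    ring

theorem hypSum_contiguous (N : ℕ) (c d y : ℝ) :
    (d + N) * hypSum N c d y =
      (d - c) * hypSum N c (d + 1) y + c * hypSum N (c + 1) (d + 1) y := by
  unfold hypSum
  rw [Finset.mul_sum, Finset.mul_sum, Finset.mul_sum, ← Finset.sum_add_distrib]
  refine Finset.sum_congr rfl fun p hp => ?_
  obtain rfl := mem_antidiagonal.mp hp
  have h1 : poch c p.1 * (c + p.1) = c * poch (c + 1) p.1 := by rw [← poch_succ, poch_succ']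
  have h2 : poch (d + p.1) p.2 * (d + p.1 + p.2) = (d + p.1) * poch (d + 1 + p.1) p.2 := by
    rw [← poch_succ, poch_succ', add_right_comm]
  push_cast
  linear_combination
    ((p.1 + p.2).choose p.1 : ℝ) * (-1) ^ p.1 * y ^ p.1 *
      (poch c p.1 * h2 + poch (d + 1 + p.1) p.2 * h1)

theorem hypSum_reflect (N : ℕ) (c d y : ℝ) :
    hypSum N c d y = (-1) ^ N * hypSum N c (c - d - N + 1) (1 - y) := by
  induction N generalizing c d with
  | zero => simp [hypSum, poch_zero]
  | succ N ih =>
    rw [hypSum_succ, hypSum_succ]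
    have h1 := ih c (d + 1)
    have h2 := ih (c + 1) (d + 1)
    have h3 := hypSum_contiguous N c d y
    rw [show c - (d + 1) - N + 1 = c - d - N by ring] at h1
    rw [show c + 1 - (d + 1) - N + 1 = c - d - N + 1 by ring] at h2
    push_cast
    rw [show c - d - ((N : ℝ) + 1) + 1 = c - d - N by ring]
    linear_combination h3 + (d - c) * h1 + c * (1 - y) * h2

theorem hypSum_eq_sum {N : ℕ} {d : ℝ} (hd : 0 < d) (c y : ℝ) :
    hypSum N c d y = poch d N * ∑ j ∈ range (N + 1),
      poch (-(N : ℝ)) j * poch c j / ((j.factorial : ℝ) * poch d j) * y ^ j := by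
  rw [hypSum, Finset.Nat.sum_antidiagonal_eq_sum_range_succ_mk, Finset.mul_sum]
  refine Finset.sum_congr rfl fun j hj => ?_
  have hjN : j ≤ N := Nat.lt_succ_iff.mp (mem_range.mp hj)
  have h1 := (poch_pos hd j).ne'
  have h2 : (j.factorial : ℝ) ≠ 0 := by positivity
  have h3 := poch_add d j (N - j)
  rw [Nat.add_sub_cancel' hjN] at h3
  rw [poch_neg_natCast, h3]
  field_simp

theorem shiftedJacobi_eq_hypSum {a : ℝ} (ha : -1 < a) (b : ℝ) (r : ℕ) (x : ℝ) :
    shiftedJacobi a b r x = hypSum r (r + a + b + 1) (a + 1) (1 - x) / (r.factorial : ℝ) := by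
  rw [shiftedJacobi, hypSum_eq_sum (by linarith)]
  ring

theorem sum_choose_mul_bernstein {j m : ℕ} (hj : j ≤ m) (x : ℝ) :
    ∑ h ∈ range (m + 1), (h.choose j : ℝ) * ((m.choose h : ℝ) * x ^ h * (1 - x) ^ (m - h)) =
      (m.choose j : ℝ) * x ^ j := by
  obtain ⟨p, rfl⟩ := Nat.exists_eq_add_of_le hj
  have hp : ∑ h ∈ range (p + 1), x ^ h * (1 - x) ^ (p - h) * (p.choose h : ℝ) = 1 := by
    rw [← add_pow]
    simp
  rw [add_assoc, Finset.sum_range_add, Finset.sum_eq_zero, zero_add]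
  · conv_rhs => rw [← mul_one (_ * x ^ j), ← hp, Finset.mul_sum]
    refine Finset.sum_congr rfl fun h hh => ?_
    have hhp : h ≤ p := Nat.lt_succ_iff.mp (mem_range.mp hh)
    have key := Nat.choose_mul (n := j + p) (k := j + h) (s := j) (by omega)
    rw [Nat.add_sub_cancel_left, Nat.add_sub_cancel_left] at key
    have key' : ((j + p).choose (j + h) : ℝ) * ((j + h).choose j : ℝ) =
        ((j + p).choose j : ℝ) * (p.choose h : ℝ) := mod_cast key
    rw [Nat.add_sub_add_left, pow_add]
    linear_combination x ^ j * x ^ h * (1 - x) ^ (p - h) * key'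
  · intro h hh
    rw [Nat.choose_eq_zero_of_lt (mem_range.mp hh)]
    simp

theorem sum_hahnQ_mul_bernstein {r m : ℕ} (hr : r ≤ m) (a b x : ℝ) :
    ∑ h ∈ range (m + 1), hahnQ r h b a m * bern m h x =
      ∑ j ∈ range (r + 1), poch (-(r : ℝ)) j * poch (r + b + a + 1) j /
        ((j.factorial : ℝ) * poch (b + 1) j) * x ^ j := by
  simp only [hahnQ, bern, Finset.sum_mul]
  rw [Finset.sum_comm]
  refine Finset.sum_congr rfl fun j hj => ?_
  have hjm : j ≤ m := (Nat.lt_succ_iff.mp (mem_range.mp hj)).trans hr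
  have h0 : (m.choose j : ℝ) ≠ 0 := mod_cast (Nat.choose_pos hjm).ne'
  have hf : (j.factorial : ℝ) ≠ 0 := by positivity
  have hratio (h : ℕ) : poch (-(h : ℝ)) j / poch (-(m : ℝ)) j = (h.choose j : ℝ) / m.choose j := by
    rw [poch_neg_natCast, poch_neg_natCast]
    exact mul_div_mul_left _ _ (mul_ne_zero (pow_ne_zero _ (by norm_num)) hf)
  have hx : x ^ j = (∑ h ∈ range (m + 1),
      (h.choose j : ℝ) * ((m.choose h : ℝ) * x ^ h * (1 - x) ^ (m - h))) / m.choose j := by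
    rw [sum_choose_mul_bernstein hjm, mul_div_cancel_left₀ _ h0]
  rw [hx, Finset.sum_div, Finset.mul_sum]
  refine Finset.sum_congr rfl fun h _ => ?_
  rw [mul_div_mul_comm, hratio]
  ring

/-- Bernstein form of the shifted Jacobi polynomials. -/
theorem shiftedJacobi_eq_sum_aCoef_mul_bern {a b : ℝ} (ha : -1 < a) (hb : -1 < b) {r m : ℕ}
    (hr : r ≤ m) (x : ℝ) :
    shiftedJacobi a b r x = ∑ h ∈ range (m + 1), aCoef m a b r h * bern m h x := by
  simp only [aCoef, mul_assoc _ (hahnQ _ _ _ _ _)]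
  rw [← Finset.mul_sum, sum_hahnQ_mul_bernstein hr, shiftedJacobi_eq_hypSum ha, hypSum_reflect,
    show (r + a + b + 1 : ℝ) - (a + 1) - r + 1 = b + 1 by ring, sub_sub_cancel,
    add_right_comm (r : ℝ) a b, hypSum_eq_sum (by linarith)]
  ring

/-- Generalized Jacobi polynomials, case `α > -1`, `β ∈ ℤ⁻`: Bernstein form. -/
theorem genJacobi_bernstein_form_neg_beta (n : ℕ) (α : ℝ) (hα : -1 < α)
    (β : ℤ) (hβ : β < 0) (hβn : -β ≤ (n : ℤ)) :
    ∀ i : ℕ, -β ≤ (i : ℤ) → i ≤ n → ∀ x : ℝ,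
      x ^ (-β).toNat * shiftedJacobi α ((-β : ℤ) : ℝ) ((i : ℤ) + β).toNat x =
        ∑ h ∈ Finset.Icc (-β).toNat n,
          (n.choose h : ℝ)⁻¹ * (((n : ℤ) + β).toNat.choose ((h : ℤ) + β).toNat : ℝ) *
            aCoef ((n : ℤ) + β).toNat α ((-β : ℤ) : ℝ) ((i : ℤ) + β).toNat ((h : ℤ) + β).toNat *
            bern n h x := by
  intro i hi hin x
  obtain ⟨k, hk⟩ : ∃ k : ℕ, -β = k := ⟨(-β).toNat, by omega⟩
  obtain rfl : β = -k := by omega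
  obtain ⟨m, rfl⟩ : ∃ m, n = k + m := Nat.exists_eq_add_of_le (by omega)
  obtain ⟨r, rfl⟩ : ∃ r, i = k + r := Nat.exists_eq_add_of_le (by omega)
  have hsub (p : ℕ) : (((k + p : ℕ) : ℤ) + -k).toNat = p := by omega
  have hb : (-1 : ℝ) < ((k : ℤ) : ℝ) := by
    have : (0 : ℝ) ≤ k := k.cast_nonneg
    push_cast
    linarith
  rw [hk, Int.toNat_natCast, hsub, hsub,
    shiftedJacobi_eq_sum_aCoef_mul_bern hα hb (show r ≤ m by omega), Finset.mul_sum,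
    ← Finset.Ico_add_one_right_eq_Icc, Finset.sum_Ico_eq_sum_range,
    show k + m + 1 - k = m + 1 by omega]
  refine Finset.sum_congr rfl fun h hh => ?_
  have hhm : h ≤ m := Nat.lt_succ_iff.mp (mem_range.mp hh)
  have h0 : ((k + m).choose (k + h) : ℝ) ≠ 0 :=
    mod_cast (Nat.choose_pos (show k + h ≤ k + m by omega)).ne'
  rw [hsub, bern, bern, Nat.add_sub_add_left, pow_add]
  field_simp
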